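/- arXiv:math/0602435 — 2 statements merged into one kernel-verified Lean document; each statement's English description precedes it below -/
import Mathlib

section
/- Fix δ > 0 and consider the ODE dy/dx = (y³ − (x − y)³)/(y·x²). Then: (i) the function y(x) = x is a solution for all x > 0; (ii) the function ȳ₁(x) = x·√(1 − δx²)·(√(1 − δx²) + √δ·x)/(1 − 2δx²) is a solution on each of the intervals (0, 1/√(2δ)) and (1/√(2δ), 1/√δ); (iii) the function ȳ₂(x) = x·√(1 − δx²)/(√(1 − δx²) + √δ·x) is a solution on the interval (0, 1/√δ). -/
open Real

noncomputable def ybar₁ (δ x : ℝ) : ℝ :=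
  x * Real.sqrt (1 - δ * x ^ 2) *
    (Real.sqrt (1 - δ * x ^ 2) + Real.sqrt δ * x) / (1 - 2 * δ * x ^ 2)

noncomputable def ybar₂ (δ x : ℝ) : ℝ :=
  x * Real.sqrt (1 - δ * x ^ 2) /
    (Real.sqrt (1 - δ * x ^ 2) + Real.sqrt δ * x)

/-- The curve `t ↦ t √(1 - c²t²) / (√(1 - c²t²) + c t)` solves the limit equation; both signs of
`c` are allowed. -/
theorem hasDerivAt_limit_solution {c x : ℝ} (hx : x ≠ 0) (hcx : 0 < 1 - c ^ 2 * x ^ 2)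
    (hne : √(1 - c ^ 2 * x ^ 2) + c * x ≠ 0) :
    HasDerivAt (fun t => t * √(1 - c ^ 2 * t ^ 2) / (√(1 - c ^ 2 * t ^ 2) + c * t))
      (((x * √(1 - c ^ 2 * x ^ 2) / (√(1 - c ^ 2 * x ^ 2) + c * x)) ^ 3 -
          (x - x * √(1 - c ^ 2 * x ^ 2) / (√(1 - c ^ 2 * x ^ 2) + c * x)) ^ 3) /
        (x * √(1 - c ^ 2 * x ^ 2) / (√(1 - c ^ 2 * x ^ 2) + c * x) * x ^ 2)) x := by
  have hw : HasDerivAt (fun t => √(1 - c ^ 2 * t ^ 2))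
      (-(c ^ 2 * (2 * x)) / (2 * √(1 - c ^ 2 * x ^ 2))) x := by
    have hpoly : HasDerivAt (fun t => 1 - c ^ 2 * t ^ 2) (-(c ^ 2 * (2 * x))) x := by
      simpa using ((hasDerivAt_pow 2 x).const_mul (c ^ 2)).const_sub 1
    exact hpoly.sqrt hcx.ne'
  have hquot := ((hasDerivAt_id x).mul hw).div (hw.add ((hasDerivAt_id x).const_mul c)) hne
  refine hquot.congr_deriv ?_
  have hpos := Real.sqrt_pos.2 hcx
  simp only [Pi.mul_apply, Pi.add_apply, id]
  generalize √(1 - c ^ 2 * x ^ 2) = w at *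
  have hsub : x - x * w / (w + c * x) = x * (c * x) / (w + c * x) := by
    rw [eq_div_iff hne, sub_mul, div_mul_cancel₀ _ hne]
    ring
  rw [hsub]
  field_simp
  ring

theorem mul_sq_lt_one_of_lt_one_div_sqrt {δ x : ℝ} (hδ : 0 < δ) (hx : 0 < x)
    (h : x < 1 / √δ) : δ * x ^ 2 < 1 := by
  rw [lt_div_iff₀ (Real.sqrt_pos.2 hδ)] at h
  have hnonneg : 0 ≤ x * √δ := by positivity
  have hsq := Real.sq_sqrt hδ.le
  have hlt : (x * √δ) ^ 2 < 1 := by nlinarith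
  rwa [mul_pow, hsq, mul_comm] at hlt

theorem one_lt_mul_sq_of_one_div_sqrt_lt {δ x : ℝ} (hδ : 0 < δ)
    (h : 1 / √δ < x) : 1 < δ * x ^ 2 := by
  rw [div_lt_iff₀ (Real.sqrt_pos.2 hδ)] at h
  have hsq := Real.sq_sqrt hδ.le
  have hlt : 1 < (x * √δ) ^ 2 := by nlinarith
  rwa [mul_pow, hsq, mul_comm] at hlt

theorem ybar₁_eq {δ x : ℝ} (hδ : 0 < δ) (hx : 0 < x) (h : δ * x ^ 2 < 1) :
    ybar₁ δ x =
      x * √(1 - (-√δ) ^ 2 * x ^ 2) / (√(1 - (-√δ) ^ 2 * x ^ 2) + -√δ * x) := by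
  have hδsq := Real.sq_sqrt hδ.le
  have hsq := Real.sq_sqrt (sub_nonneg.2 h.le)
  have hpos : 0 < √(1 - δ * x ^ 2) + √δ * x := by positivity
  have hfac : 1 - 2 * δ * x ^ 2 =
      (√(1 - δ * x ^ 2) + -√δ * x) * (√(1 - δ * x ^ 2) + √δ * x) := by
    linear_combination x ^ 2 * hδsq - hsq
  rw [neg_sq, hδsq, ybar₁, hfac, mul_div_mul_right _ _ hpos.ne']

/-- Exact solutions of the limit equation `dy/dx = (y³ − (x−y)³)/(y·x²)`:
(i) `y = x` on `(0,∞)`; (ii) `ȳ₁` on `(0, 1/√(2δ))` and `(1/√(2δ), 1/√δ)`;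
(iii) `ȳ₂` on `(0, 1/√δ)`. -/
theorem exact_solutions_of_limit_equation (δ : ℝ) (hδ : 0 < δ) :
    (∀ x : ℝ, 0 < x →
      deriv (fun t : ℝ => t) x = (x ^ 3 - (x - x) ^ 3) / (x * x ^ 2)) ∧
    (∀ x : ℝ, x ∈ Set.Ioo (0 : ℝ) (1 / Real.sqrt (2 * δ)) ∪
        Set.Ioo (1 / Real.sqrt (2 * δ)) (1 / Real.sqrt δ) →
      deriv (ybar₁ δ) x =
        ((ybar₁ δ x) ^ 3 - (x - ybar₁ δ x) ^ 3) / (ybar₁ δ x * x ^ 2)) ∧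
    (∀ x : ℝ, x ∈ Set.Ioo (0 : ℝ) (1 / Real.sqrt δ) →
      deriv (ybar₂ δ) x =
        ((ybar₂ δ x) ^ 3 - (x - ybar₂ δ x) ^ 3) / (ybar₂ δ x * x ^ 2)) := by
  have hδsq := Real.sq_sqrt hδ.le
  refine ⟨fun x hx => ?_, fun x hx => ?_, fun x hx => ?_⟩
  · rw [deriv_id'']
    field_simp
    ring
  · have hlt : 1 / √(2 * δ) < 1 / √δ :=
      one_div_lt_one_div_of_lt (Real.sqrt_pos.2 hδ) (Real.sqrt_lt_sqrt hδ.le (by linarith))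
    have hx0 : 0 < x := by
      rcases hx with hx | hx
      · exact hx.1
      · exact lt_trans (by positivity) hx.1
    have hx1 : x < 1 / √δ := by
      rcases hx with hx | hx
      · exact hx.2.trans hlt
      · exact hx.2
    have hne : 2 * δ * x ^ 2 ≠ 1 := by
      rcases hx with hx | hx
      · exact (mul_sq_lt_one_of_lt_one_div_sqrt (by positivity) hx.1 hx.2).ne
      · exact (one_lt_mul_sq_of_one_div_sqrt_lt (by positivity) hx.1).ne'
    have hδx := mul_sq_lt_one_of_lt_one_div_sqrt hδ hx0 hx1
    have hpos : 0 < 1 - (-√δ) ^ 2 * x ^ 2 := by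
      rw [neg_sq, hδsq]
      linarith
    have hden : √(1 - (-√δ) ^ 2 * x ^ 2) + -√δ * x ≠ 0 := by
      intro h0
      have hsq := Real.sq_sqrt hpos.le
      rw [eq_neg_of_add_eq_zero_left h0] at hsq
      exact hne (by linear_combination hsq - 2 * x ^ 2 * hδsq)
    have hev : ybar₁ δ =ᶠ[nhds x] fun t =>
        t * √(1 - (-√δ) ^ 2 * t ^ 2) / (√(1 - (-√δ) ^ 2 * t ^ 2) + -√δ * t) := by
      filter_upwards [Ioo_mem_nhds hx0 hx1] with t ht
      exact ybar₁_eq hδ ht.1 (mul_sq_lt_one_of_lt_one_div_sqrt hδ ht.1 ht.2)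
    rw [hev.deriv_eq, ybar₁_eq hδ hx0 hδx]
    exact (hasDerivAt_limit_solution hx0.ne' hpos hden).deriv
  · obtain ⟨hx0, hx1⟩ := hx
    have hpos : 0 < 1 - √δ ^ 2 * x ^ 2 := by
      rw [hδsq]
      linarith [mul_sq_lt_one_of_lt_one_div_sqrt hδ hx0 hx1]
    have hden : √(1 - √δ ^ 2 * x ^ 2) + √δ * x ≠ 0 := by positivity
    have hderiv := (hasDerivAt_limit_solution hx0.ne' hpos hden).deriv
    rw [hδsq] at hderiv
    exact hderiv
end

section
/- Let a(τ) = ((√2 + 1)τ + 2)/(4τ(τ + 1)) and b(τ) = ((√2 − 1)τ − 2)/(4τ(τ + 1)). Then there exist T > 2(√2 + 1), a constant M > 0, and differentiable solutions ψ₁*, ψ₂ : [T, ∞) → ℝ of the Riccati equation dv/dτ = b(τ) − a(τ)·v² such that for all τ ≥ T: (i) |ψ₁*(τ) − (√2 − 1) − 2√2(√2 − 1)/τ| ≤ M/τ² and ψ₁*(τ) > √2 − 1; (ii) |ψ₂(τ) − (1 − √2) − 2√2(√2 − 1)/(3τ)| ≤ M/τ² and ψ₂(τ) > 1 − √2. 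-/
noncomputable def aR (τ : ℝ) : ℝ := ((Real.sqrt 2 + 1) * τ + 2) / (4 * τ * (τ + 1))
noncomputable def bR (τ : ℝ) : ℝ := ((Real.sqrt 2 - 1) * τ - 2) / (4 * τ * (τ + 1))

open Filter Topology

/-- Coefficients `(yₙ, zₙ)` of the power series solution, normalised by `y₀ = 1`, `z₀ = 0`, of
`4x(1+x)Y' = εx(2Y - 2√2 Z)`, `4x(1+x)Z' = ε(2Z + x(2√2 Y - 2Z))`. -/
noncomputable def linearCoeff (ε : ℝ) : ℕ → ℝ × ℝ
  | 0 => (1, 0)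
  | n + 1 =>
    (((2 * ε - 4 * n) * (linearCoeff ε n).1 - 2 * √2 * ε * (linearCoeff ε n).2) / (4 * (n + 1)),
      (2 * √2 * ε * (linearCoeff ε n).1 - (2 * ε + 4 * n) * (linearCoeff ε n).2)
        / (4 * (n + 1) - 2 * ε))

lemma four_mul_succ_sub_pos {ε : ℝ} (hε : |ε| = 1) (n : ℕ) : 0 < 4 * ((n : ℝ) + 1) - 2 * ε := by
  have := (abs_le.mp hε.le).2
  have := n.cast_nonneg (α := ℝ)
  linarith

lemma abs_linearCoeff_le {ε : ℝ} (hε : |ε| = 1) (n : ℕ) :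
    |(linearCoeff ε n).1| ≤ 3 ^ n ∧ |(linearCoeff ε n).2| ≤ 3 ^ n := by
  induction n with
  | zero => simp [linearCoeff]
  | succ n ih =>
    obtain ⟨hy, hz⟩ := ih
    have hn := n.cast_nonneg (α := ℝ)
    have hs : √2 ≤ 3 / 2 := Real.sqrt_le_iff.mpr (by norm_num)
    have hc : |2 * √2 * ε| ≤ 3 := by
      rw [abs_mul, hε, abs_of_nonneg (by positivity)]
      linarith
    have hsub : |2 * ε - 4 * n| ≤ 4 * n + 2 := by
      rw [abs_le]; constructor <;> linarith [abs_le.mp hε.le]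
    have hadd : |2 * ε + 4 * n| ≤ 4 * n + 2 := by
      rw [abs_le]; constructor <;> linarith [abs_le.mp hε.le]
    have hp : (0 : ℝ) < 3 ^ n := by positivity
    have key : ∀ p q u v : ℝ, |p| ≤ 4 * n + 2 → |q| ≤ 3 → |u| ≤ 3 ^ n → |v| ≤ 3 ^ n →
        |p * u| + |q * v| ≤ 3 * 3 ^ n * (4 * n + 2) := by
      intro p q u v h1 h2 h3 h4
      rw [abs_mul, abs_mul]
      have := mul_le_mul h1 h3 (abs_nonneg _) (by positivity)
      have := mul_le_mul h2 h4 (abs_nonneg _) (by positivity)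
      nlinarith
    have hd := four_mul_succ_sub_pos hε n
    constructor
    · rw [linearCoeff, abs_div, abs_of_pos (a := 4 * ((n : ℝ) + 1)) (by positivity),
        div_le_iff₀ (by positivity), pow_succ']
      refine (abs_sub _ _).trans ((key _ _ _ _ hsub hc hy hz).trans ?_)
      gcongr
      linarith
    · rw [linearCoeff, abs_div, abs_of_pos hd, div_le_iff₀ hd, pow_succ']
      refine (abs_sub _ _).trans ((add_comm _ _).trans_le ((key _ _ _ _ hadd hc hz hy).trans ?_))
      gcongr
      linarith [abs_le.mp hε.le]

/-- A real power series with coefficients bounded by `Kⁿ` is analytic at `0` and may be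
differentiated termwise for `|x| < 1/K`. -/
lemma exists_powerSeries_sum {c : ℕ → ℝ} {K : ℝ} (hK : 0 < K) (hc : ∀ n, |c n| ≤ K ^ n) :
    ∃ f f' : ℝ → ℝ, AnalyticAt ℝ f 0 ∧ f 0 = c 0 ∧ HasDerivAt f (c 1) 0 ∧
      ∀ x, |x| < 1 / K → HasDerivAt f (f' x) x ∧ HasSum (fun n ↦ c n * x ^ n) (f x) ∧
        HasSum (fun n ↦ n * c n * x ^ n) (x * f' x) := by
  have hsum : ∀ x, |x| < 1 / K → Summable fun n ↦ c n * x ^ n := by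
    intro x hx
    have hKx : K * |x| < 1 := by rwa [lt_div_iff₀ hK, mul_comm] at hx
    refine .of_norm_bounded (summable_geometric_of_lt_one (by positivity) hKx) fun n ↦ ?_
    rw [Real.norm_eq_abs, abs_mul, abs_pow, mul_pow]
    gcongr
    exact hc n
  have hps : HasFPowerSeriesAt (fun x ↦ ∑' n, c n * x ^ n) (.ofScalars ℝ c) 0 := by
    rw [hasFPowerSeriesAt_iff]
    have hball : Metric.ball (0 : ℝ) (1 / K) ∈ 𝓝 0 := Metric.ball_mem_nhds _ (by positivity)
    filter_upwards [hball] with x hx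
    simpa [mul_comm] using (hsum x (by simpa using hx)).hasSum
  refine ⟨fun x ↦ ∑' n, c n * x ^ n, fun x ↦ ∑' n, c n * (n * x ^ (n - 1)), hps.analyticAt, ?_, ?_,
    fun x hx ↦ ?_⟩
  · have h := (hsum 0 (by simpa using hK)).tsum_eq_zero_add
    simpa using h
  · simpa using hps.hasDerivAt
  obtain ⟨r, hxr, hr⟩ := exists_between hx
  have hr0 : 0 < r := (abs_nonneg x).trans_lt hxr
  have hKr : K * r < 1 := by rwa [lt_div_iff₀ hK, mul_comm] at hr
  have hnorm : ‖K * r‖ < 1 := by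
    rwa [Real.norm_eq_abs, abs_of_pos (mul_pos hK hr0)]
  have hu : Summable fun n : ℕ ↦ (n : ℝ) ^ 1 * (K * r) ^ n * r⁻¹ :=
    (summable_pow_mul_geometric_of_norm_lt_one 1 hnorm).mul_right _
  have hbound : ∀ (n : ℕ) (y : ℝ), y ∈ Metric.ball (0 : ℝ) r →
      ‖c n * (n * y ^ (n - 1))‖ ≤ (n : ℝ) ^ 1 * (K * r) ^ n * r⁻¹ := by
    intro n y hy
    have hy' : |y| ≤ r := by simpa using (Metric.mem_ball.mp hy).le
    cases n with
    | zero => simp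
    | succ n =>
      have : ((n + 1 : ℕ) : ℝ) ^ 1 * (K * r) ^ (n + 1) * r⁻¹
          = K ^ (n + 1) * ((n + 1 : ℕ) * r ^ n) := by
        field_simp
        ring
      rw [this, norm_mul, norm_mul, norm_pow, Real.norm_natCast, Real.norm_eq_abs, Real.norm_eq_abs]
      gcongr
      · exact hc _
      · simpa using pow_le_pow_left₀ (abs_nonneg y) hy' n
  have hxmem : x ∈ Metric.ball (0 : ℝ) r := by simpa using hxr
  refine ⟨?_, (hsum x hx).hasSum, ?_⟩
  · have hterm : ∀ (n : ℕ) (y : ℝ), y ∈ Metric.ball (0 : ℝ) r →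
        HasDerivAt (fun y ↦ c n * y ^ n) (c n * (n * y ^ (n - 1))) y :=
      fun n y _ ↦ (hasDerivAt_pow n y).const_mul (c n)
    exact hasDerivAt_tsum_of_isPreconnected hu Metric.isOpen_ball
      (convex_ball (0 : ℝ) r).isPreconnected hterm hbound hxmem (hsum x hx) hxmem
  · have h := (Summable.of_norm_bounded hu fun n ↦ hbound n x hxmem).hasSum.mul_left x
    refine h.congr_fun fun n ↦ ?_
    cases n with
    | zero => simp
    | succ n => rw [Nat.add_sub_cancel]; ring

/-- First order Taylor expansion with quadratic remainder of a function analytic at `0`. -/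
lemma AnalyticAt.isBigO_sub_sub_deriv_mul {f : ℝ → ℝ} {d : ℝ} (hf : AnalyticAt ℝ f 0)
    (hd : HasDerivAt f d 0) :
    (fun x ↦ f x - f 0 - d * x) =O[𝓝 0] fun x ↦ x ^ 2 := by
  have h := hf.hasFPowerSeriesAt.isBigO_sub_partialSum_pow 2
  simpa [FormalMultilinearSeries.partialSum, Finset.sum_range_succ, hd.deriv, sub_sub, mul_comm]
    using h

/-- The linear system whose projectivisation is the Riccati equation in the variable `x = 1/τ`. -/
lemma exists_linearSystem_solution {ε : ℝ} (hε : |ε| = 1) :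
    ∃ Y Z Y' Z' : ℝ → ℝ, AnalyticAt ℝ Y 0 ∧ AnalyticAt ℝ Z 0 ∧ Y 0 = 1 ∧ Z 0 = 0 ∧
      DifferentiableAt ℝ Y 0 ∧ HasDerivAt Z (√2 * ε / (2 - ε)) 0 ∧
      ∀ x, |x| < 1 / 3 → HasDerivAt Y (Y' x) x ∧ HasDerivAt Z (Z' x) x ∧
        4 * x * (1 + x) * Y' x = ε * x * (2 * Y x - 2 * √2 * Z x) ∧
        4 * x * (1 + x) * Z' x = ε * (2 * Z x + x * (2 * √2 * Y x - 2 * Z x)) := by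
  obtain ⟨Y, Y', hYa, hY0, hY1, hY⟩ :=
    exists_powerSeries_sum three_pos fun n ↦ (abs_linearCoeff_le hε n).1
  obtain ⟨Z, Z', hZa, hZ0, hZ1, hZ⟩ :=
    exists_powerSeries_sum three_pos fun n ↦ (abs_linearCoeff_le hε n).2
  have hε2 : 2 - ε ≠ 0 := by linarith [(abs_le.mp hε.le).2]
  refine ⟨Y, Z, Y', Z', hYa, hZa, by simp [hY0, linearCoeff], by simp [hZ0, linearCoeff],
    hY1.differentiableAt, ?_, fun x hx ↦ ?_⟩
  · convert hZ1 using 1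
    have : 4 - 2 * ε ≠ 0 := by linarith [(abs_le.mp hε.le).2]
    simp only [linearCoeff]
    norm_num
    rw [div_eq_div_iff hε2 this]
    ring
  obtain ⟨hYd, hYs, hYs'⟩ := hY x hx
  obtain ⟨hZd, hZs, hZs'⟩ := hZ x hx
  refine ⟨hYd, hZd, ?_, ?_⟩
  · have hshift := (hasSum_nat_add_iff' 1).mpr hYs'
    have hL := ((hshift.mul_left 4).add (hYs'.mul_left (4 * x)))
    have hR := (((hYs.mul_left 2).sub (hZs.mul_left (2 * √2))).mul_left (ε * x))
    have h := (hL.sub hR).unique (a₂ := 0) ?_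
    · simp at h
      linear_combination h
    · convert hasSum_zero using 2 with n
      have hrec : 4 * ((n : ℝ) + 1) * (linearCoeff ε (n + 1)).1 =
          (2 * ε - 4 * n) * (linearCoeff ε n).1 - 2 * √2 * ε * (linearCoeff ε n).2 := by
        rw [linearCoeff, mul_div_cancel₀ _ (by positivity)]
      push_cast
      linear_combination x ^ (n + 1) * hrec
  · have hshift := (hasSum_nat_add_iff' 1).mpr hZs'
    have hshift' := (hasSum_nat_add_iff' 1).mpr hZs
    have hL := ((hshift.mul_left 4).add (hZs'.mul_left (4 * x))).sub (hshift'.mul_left (2 * ε))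
    have hR := (((hYs.mul_left (2 * √2)).sub (hZs.mul_left 2)).mul_left (ε * x))
    have h := (hL.sub hR).unique (a₂ := 0) ?_
    · simp [linearCoeff] at h
      linear_combination h
    · convert hasSum_zero using 2 with n
      have hd := four_mul_succ_sub_pos hε n
      have hrec : (4 * ((n : ℝ) + 1) - 2 * ε) * (linearCoeff ε (n + 1)).2 =
          2 * √2 * ε * (linearCoeff ε n).1 - (2 * ε + 4 * n) * (linearCoeff ε n).2 := by
        rw [linearCoeff, mul_div_cancel₀ _ hd.ne']
      push_cast
      linear_combination x ^ (n + 1) * hrec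

lemma exists_riccati_solution {ε : ℝ} (hε : |ε| = 1) :
    ∃ (M : ℝ) (ψ : ℝ → ℝ), ∀ᶠ τ in atTop,
      HasDerivAt ψ (bR τ - aR τ * ψ τ ^ 2) τ ∧
      |ψ τ - ε * (√2 - 1) - 2 * √2 * (√2 - 1) / ((2 - ε) * τ)| ≤ M / τ ^ 2 ∧
      ε * (√2 - 1) < ψ τ := by
  obtain ⟨Y, Z, Y', Z', hYa, hZa, hY0, hZ0, hYd, hZd, hYZ⟩ := exists_linearSystem_solution hε
  have hεε : ε * ε = 1 := by rw [← abs_mul_abs_self, hε, one_mul]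
  have hε2 : 0 < 2 - ε := by linarith [(abs_le.mp hε.le).2]
  have hs : √2 * √2 = 2 := Real.mul_self_sqrt zero_le_two
  have hs1 : 0 < √2 - 1 := sub_pos.mpr Real.one_lt_sqrt_two
  set k := √2 - 1 with hk
  set c := 2 * √2 * k / (2 - ε) with hc
  have hcpos : 0 < c := by positivity
  set U : ℝ → ℝ := fun x ↦ ε * k * ((Y x + Z x) / (Y x - Z x)) with hU
  have hUa : AnalyticAt ℝ U 0 :=
    analyticAt_const.mul ((hYa.add hZa).div (hYa.sub hZa) (by simp [hY0, hZ0]))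
  have hUd : HasDerivAt U c 0 := by
    have h := ((hYd.hasDerivAt.add hZd).div (hYd.hasDerivAt.sub hZd)
      (by simp [hY0, hZ0])).const_mul (ε * k)
    refine h.congr_deriv ?_
    simp only [Pi.add_apply, Pi.sub_apply, hY0, hZ0]
    rw [hc]
    field_simp
    linear_combination (2 * √2) * hεε
  obtain ⟨M, hM⟩ := (hUa.isBigO_sub_sub_deriv_mul hUd).bound
  have hU0 : U 0 = ε * k := by simp [hU, hY0, hZ0]
  have hne : ∀ᶠ x in 𝓝 (0 : ℝ), Y x - Z x ≠ 0 :=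
    (hYa.sub hZa).continuousAt.eventually_ne (by simp [hY0, hZ0])
  have hball : Metric.ball (0 : ℝ) (1 / 3) ∈ 𝓝 0 := Metric.ball_mem_nhds _ (by norm_num)
  have hinv : Tendsto (fun τ : ℝ ↦ τ⁻¹) atTop (𝓝 0) := tendsto_inv_atTop_zero
  refine ⟨M, fun τ ↦ U τ⁻¹, ?_⟩
  filter_upwards [hinv.eventually hM, hinv.eventually hne, hinv.eventually hball,
    eventually_gt_atTop 0, eventually_gt_atTop (M / c)] with τ hMτ hneτ hx hτ hτM
  rw [hU0] at hMτ
  have hbound : |U τ⁻¹ - ε * k - 2 * √2 * k / ((2 - ε) * τ)| ≤ M / τ ^ 2 := by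
    have h1 : c * τ⁻¹ = 2 * √2 * k / ((2 - ε) * τ) := by rw [hc]; field_simp
    rw [h1] at hMτ
    simpa [div_eq_mul_inv] using hMτ
  refine ⟨?_, hbound, ?_⟩
  · obtain ⟨hYd, hZd, hYe, hZe⟩ := hYZ τ⁻¹ (by simpa using hx)
    have h := ((((hYd.add hZd).div (hYd.sub hZd) hneτ).const_mul (ε * k)).comp τ
      (hasDerivAt_inv hτ.ne'))
    refine h.congr_deriv ?_
    have hY' : Y' τ⁻¹ = ε * τ * (2 * Y τ⁻¹ - 2 * √2 * Z τ⁻¹) / (4 * (τ + 1)) := by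
      field_simp at hYe ⊢
      linear_combination hYe
    have hZ' : Z' τ⁻¹ =
        ε * τ * (2 * τ * Z τ⁻¹ + 2 * √2 * Y τ⁻¹ - 2 * Z τ⁻¹) / (4 * (τ + 1)) := by
      field_simp at hZe ⊢
      linear_combination hZe
    simp only [hU, aR, bR, Pi.add_apply, Pi.sub_apply, hY', hZ', ← hk]
    generalize Y τ⁻¹ = y at *
    generalize Z τ⁻¹ = z at *
    rw [hk] at hs1 ⊢
    field_simp
    linear_combination
      (((√2 + 1) * τ + 2) * (√2 - 1) ^ 2 * (y + z) ^ 2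
        - 4 * (√2 - 1) * (y * z * τ + √2 * y ^ 2 + √2 * z ^ 2 - 2 * y * z)) * hεε
      + (τ * (√2 - 1) * (y + z) ^ 2 - 2 * (y - z) ^ 2) * hs
  · have h1 : 2 * √2 * k / ((2 - ε) * τ) = c / τ := by rw [hc]; field_simp
    rw [h1] at hbound
    have h2 : M / τ ^ 2 < c / τ := by
      rw [div_lt_iff₀ hcpos] at hτM
      rw [div_lt_div_iff₀ (by positivity) hτ]
      nlinarith
    linarith [(abs_le.mp hbound).1]

/-- Existence of solutions `ψ₁*` and `ψ₂` of the Riccati equation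
`v' = b(τ) − a(τ)v²` with the asymptotic expansions
`ψ₁*(τ) = √2 − 1 + 2√2(√2−1)/τ + O(1/τ²)` (approaching `√2 − 1` from above)
and `ψ₂(τ) = 1 − √2 + 2√2(√2−1)/(3τ) + O(1/τ²)` (approaching `1 − √2`
from above). -/
theorem riccati_asymptotic_expansions :
    ∃ (T M : ℝ) (ψ₁star ψ₂ : ℝ → ℝ),
      2 * (Real.sqrt 2 + 1) < T ∧ 0 < M ∧
      (∀ τ : ℝ, T ≤ τ →
        HasDerivWithinAt ψ₁star (bR τ - aR τ * ψ₁star τ ^ 2) (Set.Ici T) τ ∧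
        |ψ₁star τ - (Real.sqrt 2 - 1)
          - 2 * Real.sqrt 2 * (Real.sqrt 2 - 1) / τ| ≤ M / τ ^ 2 ∧
        Real.sqrt 2 - 1 < ψ₁star τ) ∧
      (∀ τ : ℝ, T ≤ τ →
        HasDerivWithinAt ψ₂ (bR τ - aR τ * ψ₂ τ ^ 2) (Set.Ici T) τ ∧
        |ψ₂ τ - (1 - Real.sqrt 2)
          - 2 * Real.sqrt 2 * (Real.sqrt 2 - 1) / (3 * τ)| ≤ M / τ ^ 2 ∧
        1 - Real.sqrt 2 < ψ₂ τ) := by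
  obtain ⟨M₁, ψ₁, h₁⟩ := exists_riccati_solution (ε := 1) (by simp)
  obtain ⟨M₂, ψ₂, h₂⟩ := exists_riccati_solution (ε := -1) (by simp)
  obtain ⟨T, hT⟩ := eventually_atTop.mp
    ((h₁.and h₂).and (eventually_gt_atTop (2 * (√2 + 1))))
  refine ⟨T, max 1 (max M₁ M₂), ψ₁, ψ₂, (hT T le_rfl).2, by positivity, fun τ hτ ↦ ?_,
    fun τ hτ ↦ ?_⟩
  · obtain ⟨hd, hb, hp⟩ := (hT τ hτ).1.1
    refine ⟨hd.hasDerivWithinAt, ?_, by simpa using hp⟩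
    norm_num at hb
    refine hb.trans ?_
    gcongr
    simp
  · obtain ⟨hd, hb, hp⟩ := (hT τ hτ).1.2
    refine ⟨hd.hasDerivWithinAt, ?_, by simpa using hp⟩
    norm_num at hb
    refine hb.trans ?_
    gcongr
    simp
end
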